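/- arXiv:math/0605086 — 2 statements merged into one kernel-verified Lean document; each statement's English description precedes it below -/
import Mathlib

section
/- Let D be an associative unital algebra over a field k and let X, Y : D ⊗ D → D ⊗ D be two twistors for D satisfying X₂₃ ∘ Y₁₂ = Y₁₂ ∘ X₂₃, X₂₃ ∘ Y₁₃ = Y₁₃ ∘ X₂₃, X₁₂ ∘ Y₂₃ = Y₂₃ ∘ X₁₂, and X₁₂ ∘ Y₁₃ = Y₁₃ ∘ X₁₂. Then Y is a twistor for the algebra D^X, X is a twistor for D^Y, X ∘ Y and Y ∘ X are twistors for D, and (D^X)^Y = D^{X∘Y} and (D^Y)^X = D^{Y∘X} as algebras. -/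
open TensorProduct

noncomputable section

/-- `T₁₂ = T ⊗ id` on `(D ⊗ D) ⊗ D`. -/
def tensor12 (k : Type*) [Field k] (D : Type*) [AddCommGroup D] [Module k D]
    (T : D ⊗[k] D →ₗ[k] D ⊗[k] D) :
    (D ⊗[k] D) ⊗[k] D →ₗ[k] (D ⊗[k] D) ⊗[k] D :=
  T.rTensor D

/-- `T₂₃ = id ⊗ T` on `(D ⊗ D) ⊗ D`. -/
def tensor23 (k : Type*) [Field k] (D : Type*) [AddCommGroup D] [Module k D]
    (T : D ⊗[k] D →ₗ[k] D ⊗[k] D) :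
    (D ⊗[k] D) ⊗[k] D →ₗ[k] (D ⊗[k] D) ⊗[k] D :=
  (TensorProduct.assoc k D D D).symm.toLinearMap ∘ₗ T.lTensor D ∘ₗ
    (TensorProduct.assoc k D D D).toLinearMap

/-- the flip `id ⊗ τ` of the last two tensor factors of `(D ⊗ D) ⊗ D`. -/
def flip23 (k : Type*) [Field k] (D : Type*) [AddCommGroup D] [Module k D] :
    (D ⊗[k] D) ⊗[k] D →ₗ[k] (D ⊗[k] D) ⊗[k] D :=
  (TensorProduct.assoc k D D D).symm.toLinearMap ∘ₗ
    ((TensorProduct.comm k D D).toLinearMap.lTensor D) ∘ₗ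
    (TensorProduct.assoc k D D D).toLinearMap

/-- `T₁₃ = (id ⊗ τ) ∘ (T ⊗ id) ∘ (id ⊗ τ)` on `(D ⊗ D) ⊗ D`. -/
def tensor13 (k : Type*) [Field k] (D : Type*) [AddCommGroup D] [Module k D]
    (T : D ⊗[k] D →ₗ[k] D ⊗[k] D) :
    (D ⊗[k] D) ⊗[k] D →ₗ[k] (D ⊗[k] D) ⊗[k] D :=
  flip23 k D ∘ₗ tensor12 k D T ∘ₗ flip23 k D

/-- `μ₁₂ = μ ⊗ id` on `(D ⊗ D) ⊗ D`, for a multiplication `m`. -/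
def mul12 (k : Type*) [Field k] (D : Type*) [AddCommGroup D] [Module k D]
    (m : D ⊗[k] D →ₗ[k] D) :
    (D ⊗[k] D) ⊗[k] D →ₗ[k] D ⊗[k] D :=
  m.rTensor D

/-- `μ₂₃ = id ⊗ μ` on `(D ⊗ D) ⊗ D`, for a multiplication `m`. -/
def mul23 (k : Type*) [Field k] (D : Type*) [AddCommGroup D] [Module k D]
    (m : D ⊗[k] D →ₗ[k] D) :
    (D ⊗[k] D) ⊗[k] D →ₗ[k] D ⊗[k] D :=
  m.lTensor D ∘ₗ (TensorProduct.assoc k D D D).toLinearMap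

/-- A twistor for a (possibly deformed) multiplication `m` with unit `e`:
`T(e ⊗ d) = e ⊗ d`, `T(d ⊗ e) = d ⊗ e`,
`μ₂₃ ∘ T₁₃ ∘ T₁₂ = T ∘ μ₂₃`, `μ₁₂ ∘ T₁₃ ∘ T₂₃ = T ∘ μ₁₂`, `T₁₂ ∘ T₂₃ = T₂₃ ∘ T₁₂`. -/
structure IsTwistor (k : Type*) [Field k] (D : Type*) [AddCommGroup D] [Module k D]
    (m : D ⊗[k] D →ₗ[k] D) (e : D) (T : D ⊗[k] D →ₗ[k] D ⊗[k] D) : Prop where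
  one_left : ∀ d : D, T (e ⊗ₜ[k] d) = e ⊗ₜ[k] d
  one_right : ∀ d : D, T (d ⊗ₜ[k] e) = d ⊗ₜ[k] e
  mul_right : mul23 k D m ∘ₗ tensor13 k D T ∘ₗ tensor12 k D T = T ∘ₗ mul23 k D m
  mul_left : mul12 k D m ∘ₗ tensor13 k D T ∘ₗ tensor23 k D T = T ∘ₗ mul12 k D m
  comm1223 : tensor12 k D T ∘ₗ tensor23 k D T = tensor23 k D T ∘ₗ tensor12 k D T

section helpers

variable (k : Type*) [Field k] (D : Type*)

section mods

variable [AddCommGroup D] [Module k D]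

/-- the flip of the first two tensor factors. -/
def flip12 : (D ⊗[k] D) ⊗[k] D →ₗ[k] (D ⊗[k] D) ⊗[k] D :=
  (TensorProduct.comm k D D).toLinearMap.rTensor D

theorem flip12_sq : flip12 k D ∘ₗ flip12 k D = LinearMap.id := by
  ext a b c
  simp [flip12]

theorem flip23_sq : flip23 k D ∘ₗ flip23 k D = LinearMap.id := by
  ext a b c
  simp [flip23]

theorem flip_key (b : D) (z : D ⊗[k] D) :
    flip12 k D ((TensorProduct.assoc k D D D).symm (b ⊗ₜ[k] z)) = flip23 k D (z ⊗ₜ[k] b) := by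
  induction z using TensorProduct.induction_on with
  | zero => simp
  | tmul x y => simp [flip12, flip23]
  | add x y hx hy => rw [TensorProduct.tmul_add, TensorProduct.add_tmul, map_add, map_add, map_add, hx, hy]

theorem tensor13_eq (T : D ⊗[k] D →ₗ[k] D ⊗[k] D) :
    tensor13 k D T = flip12 k D ∘ₗ tensor23 k D T ∘ₗ flip12 k D := by
  ext a b c
  have h := flip_key k D b (T (a ⊗ₜ[k] c))
  have h1 : flip12 k D ((a ⊗ₜ[k] b) ⊗ₜ[k] c) = (b ⊗ₜ[k] a) ⊗ₜ[k] c := by simp [flip12]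
  have h2 : flip23 k D ((a ⊗ₜ[k] b) ⊗ₜ[k] c) = (a ⊗ₜ[k] c) ⊗ₜ[k] b := by simp [flip23]
  simp [tensor13, tensor23, tensor12, h1, h2, h]

theorem tensor23_eq (T : D ⊗[k] D →ₗ[k] D ⊗[k] D) :
    tensor23 k D T = flip12 k D ∘ₗ tensor13 k D T ∘ₗ flip12 k D := by
  have h := flip12_sq k D
  rw [← Module.End.mul_eq_comp] at h
  rw [tensor13_eq]
  simp only [← Module.End.mul_eq_comp]
  change _ = _ * (_ * _)
  rw [mul_assoc, mul_assoc, h, ← mul_assoc, ← mul_assoc, h]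
  rfl

theorem tensor12_comp (S T : D ⊗[k] D →ₗ[k] D ⊗[k] D) :
    tensor12 k D (S ∘ₗ T) = tensor12 k D S ∘ₗ tensor12 k D T :=
  LinearMap.rTensor_comp _ _ _

theorem tensor13_comp (S T : D ⊗[k] D →ₗ[k] D ⊗[k] D) :
    tensor13 k D (S ∘ₗ T) = tensor13 k D S ∘ₗ tensor13 k D T := by
  ext1
  ext a b
  have h := fun x => LinearMap.congr_fun (flip23_sq k D) x
  simp only [LinearMap.comp_apply, LinearMap.id_apply] at h
  simp [tensor13, tensor12_comp, h]

theorem tensor23_comp (S T : D ⊗[k] D →ₗ[k] D ⊗[k] D) :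
    tensor23 k D (S ∘ₗ T) = tensor23 k D S ∘ₗ tensor23 k D T := by
  ext a b c
  simp [tensor23, LinearMap.lTensor_comp]

theorem mul12_comp (m : D ⊗[k] D →ₗ[k] D) (T : D ⊗[k] D →ₗ[k] D ⊗[k] D) :
    mul12 k D (m ∘ₗ T) = mul12 k D m ∘ₗ tensor12 k D T :=
  LinearMap.rTensor_comp _ _ _

theorem mul23_comp (m : D ⊗[k] D →ₗ[k] D) (T : D ⊗[k] D →ₗ[k] D ⊗[k] D) :
    mul23 k D (m ∘ₗ T) = mul23 k D m ∘ₗ tensor23 k D T := by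
  ext a b c
  simp [mul23, tensor23, LinearMap.lTensor_comp]

theorem comm_1323 (X Y : D ⊗[k] D →ₗ[k] D ⊗[k] D)
    (l2 : tensor23 k D X ∘ₗ tensor13 k D Y = tensor13 k D Y ∘ₗ tensor23 k D X) :
    tensor23 k D Y ∘ₗ tensor13 k D X = tensor13 k D X ∘ₗ tensor23 k D Y := by
  have h := fun x => LinearMap.congr_fun (flip12_sq k D) x
  have l := fun x => LinearMap.congr_fun l2 x
  rw [tensor23_eq k D Y, tensor13_eq k D X]
  apply LinearMap.ext
  intro x
  simp only [LinearMap.comp_apply, LinearMap.id_apply] at h l ⊢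
  simp only [h, l]

theorem comm_1213 (X Y : D ⊗[k] D →ₗ[k] D ⊗[k] D)
    (l4 : tensor12 k D X ∘ₗ tensor13 k D Y = tensor13 k D Y ∘ₗ tensor12 k D X) :
    tensor12 k D Y ∘ₗ tensor13 k D X = tensor13 k D X ∘ₗ tensor12 k D Y := by
  have h := fun x => LinearMap.congr_fun (flip23_sq k D) x
  have l := fun x => congrArg (flip23 k D) (LinearMap.congr_fun l4 (flip23 k D x))
  apply LinearMap.ext
  intro x
  have l := l x
  simp only [tensor13, LinearMap.comp_apply, LinearMap.id_apply] at h l ⊢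
  simp only [h] at l
  exact l.symm

theorem half (m : D ⊗[k] D →ₗ[k] D) (e : D) (X Y : D ⊗[k] D →ₗ[k] D ⊗[k] D)
    (hX : IsTwistor k D m e X) (hY : IsTwistor k D m e Y)
    (l1 : tensor23 k D X ∘ₗ tensor12 k D Y = tensor12 k D Y ∘ₗ tensor23 k D X)
    (l2 : tensor23 k D X ∘ₗ tensor13 k D Y = tensor13 k D Y ∘ₗ tensor23 k D X)
    (l3 : tensor12 k D X ∘ₗ tensor23 k D Y = tensor23 k D Y ∘ₗ tensor12 k D X)
    (l4 : tensor12 k D X ∘ₗ tensor13 k D Y = tensor13 k D Y ∘ₗ tensor12 k D X) :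
    IsTwistor k D (m ∘ₗ X) e Y ∧ IsTwistor k D m e (X ∘ₗ Y) := by
  obtain ⟨x1, x2, x3, x4, x5⟩ := hX
  obtain ⟨y1, y2, y3, y4, y5⟩ := hY
  replace x3 := fun z => LinearMap.congr_fun x3 z
  replace x4 := fun z => LinearMap.congr_fun x4 z
  replace x5 := fun z => LinearMap.congr_fun x5 z
  have y3' := fun z => LinearMap.congr_fun y3 z
  have y4' := fun z => LinearMap.congr_fun y4 z
  have y5' := fun z => LinearMap.congr_fun y5 z
  replace l1 := fun z => LinearMap.congr_fun l1 z
  replace l2 := fun z => LinearMap.congr_fun l2 z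
  replace l3 := fun z => LinearMap.congr_fun l3 z
  replace l4 := fun z => LinearMap.congr_fun l4 z
  simp only [LinearMap.comp_apply] at x3 x4 x5 y3' y4' y5' l1 l2 l3 l4
  refine ⟨⟨y1, y2, ?_, ?_, y5⟩, ⟨fun d => by simp [x1, y1], fun d => by simp [x2, y2], ?_, ?_, ?_⟩⟩
  · apply LinearMap.ext
    intro z
    simp only [mul23_comp, LinearMap.comp_apply]
    rw [l2, l1, y3']
  · apply LinearMap.ext
    intro z
    simp only [mul12_comp, LinearMap.comp_apply]
    rw [l4, l3, y4']
  · apply LinearMap.ext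
    intro z
    simp only [tensor12_comp, tensor13_comp, LinearMap.comp_apply]
    rw [← l4, x3, y3']
  · apply LinearMap.ext
    intro z
    simp only [tensor23_comp, tensor13_comp, LinearMap.comp_apply]
    rw [← l2, x4, y4']
  · apply LinearMap.ext
    intro z
    simp only [tensor23_comp, tensor12_comp, LinearMap.comp_apply]
    rw [← l1, x5, y5', l3]

end mods

end helpers

/-- Proposition 5.2 (Proposition `stdr`): if `X` and `Y` are twistors for `D` satisfying the
four commutation conditions, then `Y` is a twistor for `D^X`, `X` is a twistor for `D^Y`,
`X ∘ Y` and `Y ∘ X` are twistors for `D`, and `(D^X)^Y = D^{X∘Y}`, `(D^Y)^X = D^{Y∘X}`. -/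
theorem twistors_compose (k : Type*) [Field k] (D : Type*) [Ring D] [Algebra k D]
    (X Y : D ⊗[k] D →ₗ[k] D ⊗[k] D)
    (hX : IsTwistor k D (LinearMap.mul' k D) 1 X)
    (hY : IsTwistor k D (LinearMap.mul' k D) 1 Y)
    (l1 : tensor23 k D X ∘ₗ tensor12 k D Y = tensor12 k D Y ∘ₗ tensor23 k D X)
    (l2 : tensor23 k D X ∘ₗ tensor13 k D Y = tensor13 k D Y ∘ₗ tensor23 k D X)
    (l3 : tensor12 k D X ∘ₗ tensor23 k D Y = tensor23 k D Y ∘ₗ tensor12 k D X)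
    (l4 : tensor12 k D X ∘ₗ tensor13 k D Y = tensor13 k D Y ∘ₗ tensor12 k D X) :
    IsTwistor k D (LinearMap.mul' k D ∘ₗ X) 1 Y ∧
    IsTwistor k D (LinearMap.mul' k D ∘ₗ Y) 1 X ∧
    IsTwistor k D (LinearMap.mul' k D) 1 (X ∘ₗ Y) ∧
    IsTwistor k D (LinearMap.mul' k D) 1 (Y ∘ₗ X) ∧
    (LinearMap.mul' k D ∘ₗ X) ∘ₗ Y = LinearMap.mul' k D ∘ₗ (X ∘ₗ Y) ∧
    (LinearMap.mul' k D ∘ₗ Y) ∘ₗ X = LinearMap.mul' k D ∘ₗ (Y ∘ₗ X) := by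
  obtain ⟨a, b⟩ := half k D _ _ X Y hX hY l1 l2 l3 l4
  obtain ⟨c, d⟩ := half k D _ _ Y X hY hX l3.symm (comm_1323 k D X Y l2) l1.symm
    (comm_1213 k D X Y l4)
  exact ⟨a, c, b, d, rfl, rfl⟩
end
end

section
/- Let A, B be associative unital algebras over a field k and let R, S : B ⊗ A → A ⊗ B be two twisting maps, with notation R(b ⊗ a) = a_R ⊗ b_R and S(b ⊗ a) = a_S ⊗ b_S. Let X (respectively Y) be the twistor for A ⊗ B afforded by R (respectively S), i.e. X = (id_A ⊗ τ ⊗ id_B) ∘ (id_A ⊗ R ⊗ id_B) and Y = (id_A ⊗ τ ⊗ id_B) ∘ (id_A ⊗ S ⊗ id_B) with τ the flip. Assume that (a_R)_S ⊗ b_R ⊗ b'_S = (a_S)_R ⊗ b_R ⊗ b'_S and a_R ⊗ a'_S ⊗ (b_R)_S = a_R ⊗ a'_S ⊗ (b_S)_R for all a, a' ∈ A and b, b' ∈ B. Define R*S, S*R : B ⊗ A → A ⊗ B by (R*S)(b ⊗ a) = (a_S)_R ⊗ (b_S)_R and (S*R)(b ⊗ a) = (a_R)_S ⊗ (b_R)_S.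 Then Y is a twistor for A ⊗_R B, X is a twistor for A ⊗_S B, X ∘ Y (respectively Y ∘ X) is the twistor for A ⊗ B afforded by the twisting map R*S (respectively S*R), and (A ⊗_R B)^Y = A ⊗_{R*S} B and (A ⊗_S B)^X = A ⊗_{S*R} B as algebras. -/
open TensorProduct

noncomputable section

/-- A twisting map `R : B ⊗ A → A ⊗ B` between algebras `A` and `B`:
`R(b ⊗ 1) = 1 ⊗ b`, `R(1 ⊗ a) = a ⊗ 1`,
`R ∘ (id_B ⊗ μ_A) = (μ_A ⊗ id_B) ∘ (id_A ⊗ R) ∘ (R ⊗ id_A)` and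
`R ∘ (μ_B ⊗ id_A) = (id_A ⊗ μ_B) ∘ (R ⊗ id_B) ∘ (id_B ⊗ R)`. -/
structure IsTwistingMap (k : Type*) [Field k] (A : Type*) [Ring A] [Algebra k A]
    (B : Type*) [Ring B] [Algebra k B] (R : B ⊗[k] A →ₗ[k] A ⊗[k] B) : Prop where
  unit_B : ∀ b : B, R (b ⊗ₜ[k] (1 : A)) = (1 : A) ⊗ₜ[k] b
  unit_A : ∀ a : A, R ((1 : B) ⊗ₜ[k] a) = a ⊗ₜ[k] (1 : B)
  mul_A : R ∘ₗ (LinearMap.mul' k A).lTensor B ∘ₗ (TensorProduct.assoc k B A A).toLinearMap =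
      (LinearMap.mul' k A).rTensor B ∘ₗ (TensorProduct.assoc k A A B).symm.toLinearMap ∘ₗ
        R.lTensor A ∘ₗ (TensorProduct.assoc k A B A).toLinearMap ∘ₗ R.rTensor A
  mul_B : R ∘ₗ (LinearMap.mul' k B).rTensor A ∘ₗ (TensorProduct.assoc k B B A).symm.toLinearMap =
      (LinearMap.mul' k B).lTensor A ∘ₗ (TensorProduct.assoc k A B B).toLinearMap ∘ₗ
        R.rTensor B ∘ₗ (TensorProduct.assoc k B A B).symm.toLinearMap ∘ₗ R.lTensor B

/-- the map `T = (id_A ⊗ τ ⊗ id_B) ∘ (id_A ⊗ R ⊗ id_B)` on `(A ⊗ B) ⊗ (A ⊗ B)`,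
sending `(a ⊗ b) ⊗ (a' ⊗ b')` to `(a ⊗ b_R) ⊗ (a'_R ⊗ b')`. -/
def twistT (k : Type*) [Field k] (A : Type*) [Ring A] [Algebra k A]
    (B : Type*) [Ring B] [Algebra k B] (R : B ⊗[k] A →ₗ[k] A ⊗[k] B) :
    (A ⊗[k] B) ⊗[k] (A ⊗[k] B) →ₗ[k] (A ⊗[k] B) ⊗[k] (A ⊗[k] B) :=
  (TensorProduct.assoc k A B (A ⊗[k] B)).symm.toLinearMap ∘ₗ
    (((TensorProduct.assoc k B A B).toLinearMap ∘ₗ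
      (((TensorProduct.comm k A B).toLinearMap ∘ₗ R).rTensor B) ∘ₗ
      (TensorProduct.assoc k B A B).symm.toLinearMap).lTensor A) ∘ₗ
    (TensorProduct.assoc k A B (A ⊗[k] B)).toLinearMap

/-- the multiplication `μ_R = (μ_A ⊗ μ_B) ∘ (id_A ⊗ R ⊗ id_B)` of the twisted tensor product
`A ⊗_R B`, sending `(a ⊗ b) ⊗ (a' ⊗ b')` to `a a'_R ⊗ b_R b'`. -/
def muR (k : Type*) [Field k] (A : Type*) [Ring A] [Algebra k A]
    (B : Type*) [Ring B] [Algebra k B] (R : B ⊗[k] A →ₗ[k] A ⊗[k] B) :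
    (A ⊗[k] B) ⊗[k] (A ⊗[k] B) →ₗ[k] A ⊗[k] B :=
  TensorProduct.map (LinearMap.mul' k A) (LinearMap.mul' k B) ∘ₗ
    (TensorProduct.assoc k A A (B ⊗[k] B)).symm.toLinearMap ∘ₗ
    (((TensorProduct.assoc k A B B).toLinearMap ∘ₗ R.rTensor B ∘ₗ
      (TensorProduct.assoc k B A B).symm.toLinearMap).lTensor A) ∘ₗ
    (TensorProduct.assoc k A B (A ⊗[k] B)).toLinearMap

/-- the product twisting map `R*S : b ⊗ a ↦ (a_S)_R ⊗ (b_S)_R`,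
i.e. `R*S = R ∘ τ ∘ S` with `τ : A ⊗ B → B ⊗ A` the flip. -/
def starMap (k : Type*) [Field k] (A : Type*) [Ring A] [Algebra k A]
    (B : Type*) [Ring B] [Algebra k B]
    (R S : B ⊗[k] A →ₗ[k] A ⊗[k] B) : B ⊗[k] A →ₗ[k] A ⊗[k] B :=
  R ∘ₗ (TensorProduct.comm k A B).toLinearMap ∘ₗ S

section helpers

set_option linter.unusedSimpArgs false

variable {k : Type*} [Field k] {A : Type*} [Ring A] [Algebra k A]
  {B : Type*} [Ring B] [Algebra k B]

/-- `(a_R)_S ⊗ b_R ⊗ b'_S = (a_S)_R ⊗ b_R ⊗ b'_S`. -/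
def Cond1 (R S : B ⊗[k] A →ₗ[k] A ⊗[k] B) : Prop :=
  ∀ (b b' : B) (a : A),
    (TensorProduct.assoc k A B B).symm ((TensorProduct.comm k B B).toLinearMap.lTensor A
      (TensorProduct.assoc k A B B (S.rTensor B ((TensorProduct.assoc k B A B).symm
        (b' ⊗ₜ[k] R (b ⊗ₜ[k] a)))))) =
    R.rTensor B ((TensorProduct.assoc k B A B).symm (b ⊗ₜ[k] S (b' ⊗ₜ[k] a)))

def Cond2 (R S : B ⊗[k] A →ₗ[k] A ⊗[k] B) : Prop :=
  ∀ (b : B) (a a' : A),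
    (TensorProduct.assoc k A A B).symm (S.lTensor A (TensorProduct.assoc k A B A
      (R (b ⊗ₜ[k] a) ⊗ₜ[k] a'))) =
    (TensorProduct.comm k A A).toLinearMap.rTensor B ((TensorProduct.assoc k A A B).symm
      (R.lTensor A (TensorProduct.assoc k A B A (S (b ⊗ₜ[k] a') ⊗ₜ[k] a))))

/-- The first compatibility condition is symmetric in the two maps: exchange `b` and `b'`. -/
theorem Cond1.symm {R S : B ⊗[k] A →ₗ[k] A ⊗[k] B} (h : Cond1 R S) : Cond1 S R := by
  intro b b' a
  have := congrArg ((TensorProduct.assoc k A B B).symm.toLinearMap ∘ₗ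
    (TensorProduct.comm k B B).toLinearMap.lTensor A ∘ₗ
      (TensorProduct.assoc k A B B).toLinearMap) (h b' b a)
  simp only [LinearMap.comp_apply, LinearEquiv.coe_coe, LinearEquiv.apply_symm_apply] at this
  rw [← this, ← LinearMap.comp_apply (LinearMap.lTensor A _) (LinearMap.lTensor A _),
    ← LinearMap.lTensor_comp]
  simp [← LinearEquiv.coe_trans]

/-- Likewise the second condition; here one exchanges `a` and `a'`. -/
theorem Cond2.symm {R S : B ⊗[k] A →ₗ[k] A ⊗[k] B} (h : Cond2 R S) : Cond2 S R := by
  intro b a a'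
  rw [h b a' a, ← LinearMap.comp_apply (LinearMap.rTensor B _) (LinearMap.rTensor B _),
    ← LinearMap.rTensor_comp]
  simp [← LinearEquiv.coe_trans]

/-- The ordinary flip, i.e. the trivial twisting, is compatible with everything. -/
theorem cond1_flip (S : B ⊗[k] A →ₗ[k] A ⊗[k] B) :
    Cond1 (TensorProduct.comm k B A).toLinearMap S := by
  intro b b' a
  simp only [LinearEquiv.coe_coe, comm_tmul, assoc_symm_tmul,
    LinearMap.rTensor_tmul]
  induction S (b' ⊗ₜ[k] a) using TensorProduct.induction_on with
  | zero => simp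
  | tmul x y => simp
  | add x y hx hy => simp only [add_tmul, tmul_add, map_add, hx, hy]

/-- Second half of compatibility with the trivial twisting. -/
theorem cond2_flip (S : B ⊗[k] A →ₗ[k] A ⊗[k] B) :
    Cond2 (TensorProduct.comm k B A).toLinearMap S := by
  intro b a a'
  simp only [LinearEquiv.coe_coe, comm_tmul, assoc_tmul,
    LinearMap.lTensor_tmul]
  induction S (b ⊗ₜ[k] a') using TensorProduct.induction_on with
  | zero => simp
  | tmul x y => simp
  | add x y hx hy => simp only [add_tmul, tmul_add, map_add, hx, hy]

/-- Value of the afforded twistor on pure tensors, as a linear function of `R (b ⊗ a')`. -/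
theorem twistT_tmul (R : B ⊗[k] A →ₗ[k] A ⊗[k] B) (a a' : A) (b b' : B) :
    twistT k A B R ((a ⊗ₜ[k] b) ⊗ₜ[k] (a' ⊗ₜ[k] b')) =
      TensorProduct.map (TensorProduct.mk k A B a) ((TensorProduct.mk k A B).flip b')
        (TensorProduct.comm k A B (R (b ⊗ₜ[k] a'))) := by
  simp only [twistT, LinearMap.comp_apply, LinearEquiv.coe_coe, assoc_tmul,
    LinearMap.lTensor_tmul, assoc_symm_tmul, LinearMap.rTensor_tmul]
  induction R (b ⊗ₜ[k] a') using TensorProduct.induction_on with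
  | zero => simp
  | tmul x y => simp
  | add x y hx hy => simp only [add_tmul, tmul_add, map_add, hx, hy]

/-- Value of the twisted product on pure tensors. -/
theorem muR_tmul (R : B ⊗[k] A →ₗ[k] A ⊗[k] B) (a a' : A) (b b' : B) :
    muR k A B R ((a ⊗ₜ[k] b) ⊗ₜ[k] (a' ⊗ₜ[k] b')) =
      TensorProduct.map (LinearMap.mulLeft k a) (LinearMap.mulRight k b') (R (b ⊗ₜ[k] a')) := by
  simp only [muR, LinearMap.comp_apply, LinearEquiv.coe_coe, assoc_tmul,
    LinearMap.lTensor_tmul, assoc_symm_tmul, LinearMap.rTensor_tmul]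
  induction R (b ⊗ₜ[k] a') using TensorProduct.induction_on with
  | zero => simp
  | tmul x y => simp
  | add x y hx hy => simp only [add_tmul, tmul_add, map_add, hx, hy]

/-- The flip gives back the usual algebra structure. -/
theorem muR_flip : muR k A B (TensorProduct.comm k B A).toLinearMap =
    LinearMap.mul' k (A ⊗[k] B) := by
  ext a b a' b'
  simp [muR_tmul]

theorem twistT_comp (R S : B ⊗[k] A →ₗ[k] A ⊗[k] B) :
    twistT k A B R ∘ₗ twistT k A B S = twistT k A B (starMap k A B R S) := by
  ext a b a' b'
  simp only [TensorProduct.AlgebraTensorModule.curry_apply, LinearMap.restrictScalars_self,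
    TensorProduct.curry_apply, LinearMap.comp_apply, twistT_tmul, starMap, LinearEquiv.coe_coe]
  induction S (b ⊗ₜ[k] a') using TensorProduct.induction_on with
  | zero => simp
  | tmul x y => simp [twistT_tmul]
  | add x y hx hy => simp only [add_tmul, tmul_add, map_add, hx, hy]

theorem muR_comp (R S : B ⊗[k] A →ₗ[k] A ⊗[k] B) :
    muR k A B R ∘ₗ twistT k A B S = muR k A B (starMap k A B R S) := by
  ext a b a' b'
  simp only [TensorProduct.AlgebraTensorModule.curry_apply, LinearMap.restrictScalars_self,
    TensorProduct.curry_apply, LinearMap.comp_apply, twistT_tmul, muR_tmul, starMap,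
    LinearEquiv.coe_coe]
  induction S (b ⊗ₜ[k] a') using TensorProduct.induction_on with
  | zero => simp
  | tmul x y => simp [muR_tmul]
  | add x y hx hy => simp only [add_tmul, tmul_add, map_add, hx, hy]

theorem IsTwistingMap.mul_A' {R : B ⊗[k] A →ₗ[k] A ⊗[k] B} (h : IsTwistingMap k A B R)
    (b : B) (a a' : A) : R (b ⊗ₜ[k] (a * a')) =
      (LinearMap.mul' k A).rTensor B ((TensorProduct.assoc k A A B).symm
        (R.lTensor A (TensorProduct.assoc k A B A (R (b ⊗ₜ[k] a) ⊗ₜ[k] a')))) := by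
  simpa using LinearMap.congr_fun h.mul_A ((b ⊗ₜ[k] a) ⊗ₜ[k] a')

theorem IsTwistingMap.mul_B' {R : B ⊗[k] A →ₗ[k] A ⊗[k] B} (h : IsTwistingMap k A B R)
    (b b' : B) (a : A) : R ((b * b') ⊗ₜ[k] a) =
      (LinearMap.mul' k B).lTensor A ((TensorProduct.assoc k A B B)
        (R.rTensor B ((TensorProduct.assoc k B A B).symm (b ⊗ₜ[k] R (b' ⊗ₜ[k] a))))) := by
  simpa using LinearMap.congr_fun h.mul_B (b ⊗ₜ[k] (b' ⊗ₜ[k] a))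

theorem star_mul_A {R S : B ⊗[k] A →ₗ[k] A ⊗[k] B} (hR : IsTwistingMap k A B R)
    (hS : IsTwistingMap k A B S) (h2 : Cond2 R S) (b : B) (a a' : A) :
    starMap k A B R S (b ⊗ₜ[k] (a * a')) =
      (LinearMap.mul' k A).rTensor B ((TensorProduct.assoc k A A B).symm
        ((starMap k A B R S).lTensor A (TensorProduct.assoc k A B A
          (starMap k A B R S (b ⊗ₜ[k] a) ⊗ₜ[k] a')))) := by
  simp only [starMap, LinearMap.comp_apply, LinearEquiv.coe_coe, hS.mul_A']
  induction S (b ⊗ₜ[k] a) using TensorProduct.induction_on with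
  | zero => simp
  | add x y hx hy => simp only [add_tmul, tmul_add, map_add, hx, hy]
  | tmul u v =>
    have key := congrArg ((LinearMap.mul' k A).rTensor B ∘ₗ
      (TensorProduct.assoc k A A B).symm.toLinearMap ∘ₗ
      (R ∘ₗ (TensorProduct.comm k A B).toLinearMap).lTensor A ∘ₗ
      (TensorProduct.assoc k A A B).toLinearMap) (h2 v u a')
    simp only [LinearMap.comp_apply, LinearEquiv.coe_coe, LinearEquiv.apply_symm_apply] at key
    simp only [comm_tmul, assoc_tmul, LinearMap.lTensor_tmul]
    refine Eq.trans (Eq.symm ?_) (key.symm.trans ?_)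
    · induction S (v ⊗ₜ[k] a') using TensorProduct.induction_on with
      | zero => simp
      | add x y hx hy => simp only [add_tmul, tmul_add, map_add, hx, hy]
      | tmul w v' =>
        simp only [comm_tmul, assoc_tmul, LinearMap.lTensor_tmul,
          assoc_symm_tmul, LinearMap.rTensor_tmul, LinearMap.mul'_apply, hR.mul_A']
        induction R (v' ⊗ₜ[k] u) using TensorProduct.induction_on with
        | zero => simp
        | add x y hx hy => simp only [add_tmul, tmul_add, map_add, hx, hy]
        | tmul p q => simp
    · induction R (v ⊗ₜ[k] u) using TensorProduct.induction_on with
      | zero => simp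
      | add x y hx hy => simp only [add_tmul, tmul_add, map_add, hx, hy]
      | tmul p q => simp

/-- Multiplicativity of `R*S` in `B`, from the first condition and `(p ⊗ x) ⊗ q ↦ R(q ⊗ p) · x`. -/
theorem star_mul_B {R S : B ⊗[k] A →ₗ[k] A ⊗[k] B} (hR : IsTwistingMap k A B R)
    (hS : IsTwistingMap k A B S) (h1 : Cond1 R S) (b b' : B) (a : A) :
    starMap k A B R S ((b * b') ⊗ₜ[k] a) =
      (LinearMap.mul' k B).lTensor A ((TensorProduct.assoc k A B B)
        ((starMap k A B R S).rTensor B ((TensorProduct.assoc k B A B).symm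
          (b ⊗ₜ[k] starMap k A B R S (b' ⊗ₜ[k] a))))) := by
  simp only [starMap, LinearMap.comp_apply, LinearEquiv.coe_coe, hS.mul_B']
  induction S (b' ⊗ₜ[k] a) using TensorProduct.induction_on with
  | zero => simp
  | add x y hx hy => simp only [add_tmul, tmul_add, map_add, hx, hy]
  | tmul u v =>
    have key := congrArg ((LinearMap.mul' k B).lTensor A ∘ₗ
      (TensorProduct.assoc k A B B).toLinearMap ∘ₗ R.rTensor B ∘ₗ
      (TensorProduct.assoc k B A B).symm.toLinearMap ∘ₗ
      (TensorProduct.comm k (A ⊗[k] B) B).toLinearMap) (h1 v b u)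
    simp only [LinearMap.comp_apply, LinearEquiv.coe_coe] at key
    simp only [comm_tmul, assoc_symm_tmul, LinearMap.rTensor_tmul]
    refine Eq.trans (Eq.symm ?_) (key.symm.trans ?_)
    · induction S (b ⊗ₜ[k] u) using TensorProduct.induction_on with
      | zero => simp
      | add x y hx hy => simp only [add_tmul, tmul_add, map_add, hx, hy]
      | tmul w v' =>
        simp only [comm_tmul, assoc_tmul, LinearMap.lTensor_tmul,
          assoc_symm_tmul, LinearMap.rTensor_tmul, LinearMap.mul'_apply, hR.mul_B']
    · induction R (v ⊗ₜ[k] u) using TensorProduct.induction_on with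
      | zero => simp
      | add x y hx hy => simp only [add_tmul, tmul_add, map_add, hx, hy]
      | tmul p q =>
        simp only [comm_tmul, assoc_symm_tmul, LinearMap.rTensor_tmul,
          LinearMap.comp_apply, LinearEquiv.coe_coe]
        induction S (b ⊗ₜ[k] p) using TensorProduct.induction_on with
        | zero => simp
        | add x y hx hy => simp only [add_tmul, tmul_add, map_add, hx, hy]
        | tmul r s => simp

/-- Compatible twisting maps have a product which is again a twisting map. -/
theorem isTwistingMap_star {R S : B ⊗[k] A →ₗ[k] A ⊗[k] B} (hR : IsTwistingMap k A B R)
    (hS : IsTwistingMap k A B S) (h1 : Cond1 R S) (h2 : Cond2 R S) :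
    IsTwistingMap k A B (starMap k A B R S) where
  unit_B b := by simp [starMap, hS.unit_B, hR.unit_B]
  unit_A a := by simp [starMap, hS.unit_A, hR.unit_A]
  mul_A := by
    ext b a a'
    simpa using star_mul_A hR hS h2 b a a'
  mul_B := by
    ext b b' a
    simpa using star_mul_B hR hS h1 b b' a

set_option maxHeartbeats 4000000 in
/-- Main lemma: if `S` is a twisting map and `R` any compatible linear map, the twistor of `S`
satisfies the axioms for the product `μ_R`. Only multiplicativity of `S` is used, never that of `R`,
so the case of the flip yields twistors for the untwisted algebra. -/
theorem isTwistor_twistT {R S : B ⊗[k] A →ₗ[k] A ⊗[k] B}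
    (hS : IsTwistingMap k A B S) (h1 : Cond1 R S) (h2 : Cond2 R S) :
    IsTwistor k (A ⊗[k] B) (muR k A B R) ((1 : A) ⊗ₜ[k] (1 : B)) (twistT k A B S) where
  one_left d := by
    induction d using TensorProduct.induction_on with
    | zero => simp
    | add x y hx hy => simp only [tmul_add, map_add, hx, hy]
    | tmul a b => simp [twistT_tmul, hS.unit_A]
  one_right d := by
    induction d using TensorProduct.induction_on with
    | zero => simp
    | add x y hx hy => simp only [add_tmul, map_add, hx, hy]
    | tmul a b => simp [twistT_tmul, hS.unit_B]
  mul_right := by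
    ext a b a' b' a'' b''
    simp only [TensorProduct.AlgebraTensorModule.curry_apply, LinearMap.restrictScalars_self,
      TensorProduct.curry_apply, LinearMap.comp_apply, tensor12, tensor13, tensor23, flip23,
      mul12, mul23, LinearEquiv.coe_coe, LinearMap.rTensor_tmul, assoc_tmul,
      LinearMap.lTensor_tmul, twistT_tmul, muR_tmul]
    have e : ∀ t : A ⊗[k] B, twistT k A B S ((a ⊗ₜ[k] b) ⊗ₜ[k]
        (TensorProduct.map (LinearMap.mulLeft k a') (LinearMap.mulRight k b'') t)) =
        (TensorProduct.map (TensorProduct.mk k A B a)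
          (TensorProduct.map (LinearMap.mul' k A) (LinearMap.mulRight k b'')) ∘ₗ
        (TensorProduct.assoc k A A B).symm.toLinearMap.lTensor B ∘ₗ
        (TensorProduct.assoc k B A (A ⊗[k] B)).toLinearMap ∘ₗ
        (TensorProduct.comm k A B).toLinearMap.rTensor (A ⊗[k] B))
          (twistT k A B S (S (b ⊗ₜ[k] a') ⊗ₜ[k] t)) := by
      intro t
      induction t using TensorProduct.induction_on with
      | zero => simp
      | add x y hx hy => simp only [add_tmul, tmul_add, map_add, hx, hy]
      | tmul y z =>
        simp [twistT_tmul, muR_tmul, hS.mul_A']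
        induction S (b ⊗ₜ[k] a') using TensorProduct.induction_on with
        | zero => simp
        | add x y hx hy => simp only [add_tmul, tmul_add, map_add, hx, hy]
        | tmul u v =>
          simp [twistT_tmul, muR_tmul]
          induction S (v ⊗ₜ[k] y) using TensorProduct.induction_on with
          | zero => simp
          | add x y hx hy => simp only [add_tmul, tmul_add, map_add, hx, hy]
          | tmul w x => simp
    rw [e]
    induction S (b ⊗ₜ[k] a') using TensorProduct.induction_on with
    | zero => simp
    | add x y hx hy => simp only [add_tmul, tmul_add, map_add, hx, hy]
    | tmul u v =>
      have key := congrArg (TensorProduct.map (TensorProduct.mk k A B a)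
        (TensorProduct.map (LinearMap.mulLeft k u) (LinearMap.mulRight k b'')) ∘ₗ
        (TensorProduct.comm k (A ⊗[k] B) B).toLinearMap) (h1 b' v a'')
      simp only [LinearMap.comp_apply, LinearEquiv.coe_coe] at key
      refine Eq.trans (Eq.symm ?_) (key.symm.trans ?_)
      · simp [twistT_tmul, muR_tmul]
        induction S (v ⊗ₜ[k] a'') using TensorProduct.induction_on with
        | zero => simp
        | add x y hx hy => simp only [add_tmul, tmul_add, map_add, hx, hy]
        | tmul w x =>
          simp [muR_tmul]
      · induction R (b' ⊗ₜ[k] a'') using TensorProduct.induction_on with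
        | zero => simp
        | add x y hx hy => simp only [add_tmul, tmul_add, map_add, hx, hy]
        | tmul y z =>
          simp [twistT_tmul, muR_tmul]
          induction S (v ⊗ₜ[k] y) using TensorProduct.induction_on with
          | zero => simp
          | add x y hx hy => simp only [add_tmul, tmul_add, map_add, hx, hy]
          | tmul w x => simp
  mul_left := by
    ext a b a' b' a'' b''
    simp only [TensorProduct.AlgebraTensorModule.curry_apply, LinearMap.restrictScalars_self,
      TensorProduct.curry_apply, LinearMap.comp_apply, tensor12, tensor13, tensor23, flip23,
      mul12, mul23, LinearEquiv.coe_coe, LinearMap.rTensor_tmul, assoc_tmul,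
      LinearMap.lTensor_tmul, twistT_tmul, muR_tmul]
    have e : ∀ t : A ⊗[k] B, twistT k A B S
        ((TensorProduct.map (LinearMap.mulLeft k a) (LinearMap.mulRight k b') t) ⊗ₜ[k]
          (a'' ⊗ₜ[k] b'')) =
        (TensorProduct.map (TensorProduct.map (LinearMap.mulLeft k a) (LinearMap.mul' k B))
          ((TensorProduct.mk k A B).flip b'') ∘ₗ
        (TensorProduct.assoc k A B B).toLinearMap.rTensor A ∘ₗ
        (TensorProduct.assoc k (A ⊗[k] B) B A).symm.toLinearMap ∘ₗ
        (TensorProduct.comm k A B).toLinearMap.lTensor (A ⊗[k] B))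
          (twistT k A B S (t ⊗ₜ[k] S (b' ⊗ₜ[k] a''))) := by
      intro t
      induction t using TensorProduct.induction_on with
      | zero => simp
      | add x y hx hy => simp only [add_tmul, tmul_add, map_add, hx, hy]
      | tmul p q =>
        simp [twistT_tmul, muR_tmul, hS.mul_B']
        induction S (b' ⊗ₜ[k] a'') using TensorProduct.induction_on with
        | zero => simp
        | add x y hx hy => simp only [add_tmul, tmul_add, map_add, hx, hy]
        | tmul u v =>
          simp [twistT_tmul, muR_tmul]
          induction S (q ⊗ₜ[k] u) using TensorProduct.induction_on with
          | zero => simp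
          | add x y hx hy => simp only [add_tmul, tmul_add, map_add, hx, hy]
          | tmul w x => simp
    rw [e]
    induction S (b' ⊗ₜ[k] a'') using TensorProduct.induction_on with
    | zero => simp
    | add x y hx hy => simp only [add_tmul, tmul_add, map_add, hx, hy]
    | tmul u v =>
      have key := congrArg (TensorProduct.map
        (TensorProduct.map (LinearMap.mulLeft k a) (LinearMap.mulRight k v))
          ((TensorProduct.mk k A B).flip b'') ∘ₗ
        (TensorProduct.assoc k A B A).symm.toLinearMap ∘ₗ
        (TensorProduct.comm k A B).toLinearMap.lTensor A ∘ₗ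
        (TensorProduct.assoc k A A B).toLinearMap) (h2 b a' u)
      simp only [LinearMap.comp_apply, LinearEquiv.coe_coe] at key
      refine Eq.trans (Eq.symm ?_) (key.symm.trans ?_)
      · simp [twistT_tmul, muR_tmul]
        induction S (b ⊗ₜ[k] u) using TensorProduct.induction_on with
        | zero => simp
        | add x y hx hy => simp only [add_tmul, tmul_add, map_add, hx, hy]
        | tmul w x =>
          simp [muR_tmul]
          induction R (x ⊗ₜ[k] a') using TensorProduct.induction_on with
          | zero => simp
          | add x y hx hy => simp only [add_tmul, tmul_add, map_add, hx, hy]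
          | tmul p q => simp
      · induction R (b ⊗ₜ[k] a') using TensorProduct.induction_on with
        | zero => simp
        | add x y hx hy => simp only [add_tmul, tmul_add, map_add, hx, hy]
        | tmul p q =>
          simp [twistT_tmul, muR_tmul]
          induction S (q ⊗ₜ[k] u) using TensorProduct.induction_on with
          | zero => simp
          | add x y hx hy => simp only [add_tmul, tmul_add, map_add, hx, hy]
          | tmul w x => simp
  comm1223 := by
    ext a b a' b' a'' b''
    simp only [TensorProduct.AlgebraTensorModule.curry_apply, LinearMap.restrictScalars_self,
      TensorProduct.curry_apply, LinearMap.comp_apply, tensor12, tensor13, tensor23, flip23,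
      mul12, mul23, LinearEquiv.coe_coe, LinearMap.rTensor_tmul, assoc_tmul,
      LinearMap.lTensor_tmul, twistT_tmul, muR_tmul]
    have e : ∀ t : A ⊗[k] B, (twistT k A B S).rTensor (A ⊗[k] B)
        ((TensorProduct.assoc k (A ⊗[k] B) (A ⊗[k] B) (A ⊗[k] B)).symm ((a ⊗ₜ[k] b) ⊗ₜ[k]
          (TensorProduct.map (TensorProduct.mk k A B a') ((TensorProduct.mk k A B).flip b'')
            (TensorProduct.comm k A B t)))) =
        (TensorProduct.map (TensorProduct.map (TensorProduct.mk k A B a) LinearMap.id)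
          ((TensorProduct.mk k A B).flip b'') ∘ₗ
        (TensorProduct.assoc k B A B).toLinearMap.rTensor A ∘ₗ
        (TensorProduct.assoc k (B ⊗[k] A) B A).symm.toLinearMap ∘ₗ
        TensorProduct.map (TensorProduct.comm k A B).toLinearMap
          (TensorProduct.comm k A B).toLinearMap) (S (b ⊗ₜ[k] a') ⊗ₜ[k] t) := by
      intro t
      induction t using TensorProduct.induction_on with
      | zero => simp
      | add x y hx hy => simp only [add_tmul, tmul_add, map_add, hx, hy]
      | tmul w x =>
        simp [twistT_tmul, muR_tmul]
        induction S (b ⊗ₜ[k] a') using TensorProduct.induction_on with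
        | zero => simp
        | add x y hx hy => simp only [add_tmul, tmul_add, map_add, hx, hy]
        | tmul u v => simp
    rw [e]
    induction S (b ⊗ₜ[k] a') using TensorProduct.induction_on with
    | zero => simp
    | add x y hx hy => simp only [add_tmul, tmul_add, map_add, hx, hy]
    | tmul u v =>
      simp [twistT_tmul, muR_tmul]
      induction S (b' ⊗ₜ[k] a'') using TensorProduct.induction_on with
      | zero => simp
      | add x y hx hy => simp only [add_tmul, tmul_add, map_add, hx, hy]
      | tmul w x => simp

end helpers

/-- Corollary 5.4: given twisting maps `R, S : B ⊗ A → A ⊗ B` whose afforded twistors `X`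
and `Y` satisfy the two compatibility conditions
`(a_R)_S ⊗ b_R ⊗ b'_S = (a_S)_R ⊗ b_R ⊗ b'_S` and
`a_R ⊗ a'_S ⊗ (b_R)_S = a_R ⊗ a'_S ⊗ (b_S)_R`, the twistor `Y` is a twistor for `A ⊗_R B`,
`X` is a twistor for `A ⊗_S B`, `X ∘ Y` (resp. `Y ∘ X`) is the twistor afforded by the
twisting map `R*S` (resp. `S*R`), and `(A ⊗_R B)^Y = A ⊗_{R*S} B`,
`(A ⊗_S B)^X = A ⊗_{S*R} B`. -/
theorem two_twisting_maps (k : Type*) [Field k] (A : Type*) [Ring A] [Algebra k A]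
    (B : Type*) [Ring B] [Algebra k B] (R S : B ⊗[k] A →ₗ[k] A ⊗[k] B)
    (hR : IsTwistingMap k A B R) (hS : IsTwistingMap k A B S)
    (hcond1 :
      ((TensorProduct.assoc k A B B).symm.toLinearMap ∘ₗ
        (TensorProduct.comm k B B).toLinearMap.lTensor A ∘ₗ
        (TensorProduct.assoc k A B B).toLinearMap ∘ₗ
        S.rTensor B ∘ₗ
        (TensorProduct.assoc k B A B).symm.toLinearMap ∘ₗ
        R.lTensor B ∘ₗ
        (TensorProduct.assoc k B B A).toLinearMap ∘ₗ
        (TensorProduct.comm k B B).toLinearMap.rTensor A ∘ₗ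
        (TensorProduct.assoc k B B A).symm.toLinearMap :
        B ⊗[k] (B ⊗[k] A) →ₗ[k] (A ⊗[k] B) ⊗[k] B) =
      R.rTensor B ∘ₗ (TensorProduct.assoc k B A B).symm.toLinearMap ∘ₗ S.lTensor B)
    (hcond2 :
      ((TensorProduct.assoc k A A B).symm.toLinearMap ∘ₗ
        S.lTensor A ∘ₗ
        (TensorProduct.assoc k A B A).toLinearMap ∘ₗ
        R.rTensor A :
        (B ⊗[k] A) ⊗[k] A →ₗ[k] (A ⊗[k] A) ⊗[k] B) =
      (TensorProduct.comm k A A).toLinearMap.rTensor B ∘ₗ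
        (TensorProduct.assoc k A A B).symm.toLinearMap ∘ₗ
        R.lTensor A ∘ₗ
        (TensorProduct.assoc k A B A).toLinearMap ∘ₗ
        S.rTensor A ∘ₗ
        (TensorProduct.assoc k B A A).symm.toLinearMap ∘ₗ
        (TensorProduct.comm k A A).toLinearMap.lTensor B ∘ₗ
        (TensorProduct.assoc k B A A).toLinearMap) :
    IsTwistor k (A ⊗[k] B) (muR k A B R) ((1 : A) ⊗ₜ[k] (1 : B)) (twistT k A B S) ∧
    IsTwistor k (A ⊗[k] B) (muR k A B S) ((1 : A) ⊗ₜ[k] (1 : B)) (twistT k A B R) ∧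
    IsTwistingMap k A B (starMap k A B R S) ∧
    IsTwistingMap k A B (starMap k A B S R) ∧
    twistT k A B R ∘ₗ twistT k A B S = twistT k A B (starMap k A B R S) ∧
    twistT k A B S ∘ₗ twistT k A B R = twistT k A B (starMap k A B S R) ∧
    IsTwistor k (A ⊗[k] B) (LinearMap.mul' k (A ⊗[k] B)) 1
      (twistT k A B R ∘ₗ twistT k A B S) ∧
    IsTwistor k (A ⊗[k] B) (LinearMap.mul' k (A ⊗[k] B)) 1
      (twistT k A B S ∘ₗ twistT k A B R) ∧
    muR k A B R ∘ₗ twistT k A B S = muR k A B (starMap k A B R S) ∧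
    muR k A B S ∘ₗ twistT k A B R = muR k A B (starMap k A B S R) := by
  have c1 : Cond1 R S := by
    intro b b' a
    simpa using LinearMap.congr_fun hcond1 (b ⊗ₜ[k] (b' ⊗ₜ[k] a))
  have c2 : Cond2 R S := by
    intro b a a'
    simpa using LinearMap.congr_fun hcond2 ((b ⊗ₜ[k] a) ⊗ₜ[k] a')
  have hRS := isTwistingMap_star hR hS c1 c2
  have hSR := isTwistingMap_star hS hR c1.symm c2.symm
  refine ⟨isTwistor_twistT hS c1 c2, isTwistor_twistT hR c1.symm c2.symm, hRS, hSR,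
    twistT_comp R S, twistT_comp S R, ?_, ?_, muR_comp R S, muR_comp S R⟩
  · rw [twistT_comp, ← muR_flip]
    exact isTwistor_twistT hRS (cond1_flip _) (cond2_flip _)
  · rw [twistT_comp, ← muR_flip]
    exact isTwistor_twistT hSR (cond1_flip _) (cond2_flip _)
end
end
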